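/- Let Γ ≤ Sim_L(ℝ^{m+2}) act freely, properly discontinuously and cocompactly on ℝ^{m+2}. Then Γ ⊆ E(m+1,1); that is, every element of Γ has similarity factor λ = 1, so that ℝ^{m+2}/Γ is a compact complete Lorentzian flat space form. -/

import Mathlib

noncomputable section

/-- `Vec n` is the euclidean space `ℝ^n`. -/
abbrev Vec (n : ℕ) : Type := Fin n → ℝ

/-- The group of invertible affine transformations of `ℝ^n`. -/
abbrev AffGroup (n : ℕ) := Vec n ≃ᵃ[ℝ] Vec n

/-- The standard Lorentz quadratic form `Q(x) = x₁² + ⋯ + x_{m+1}² − x_{m+2}²` on `ℝ^{m+2}`. -/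
def lorentzQ (m : ℕ) (x : Vec (m + 2)) : ℝ :=
  (∑ i : Fin (m + 1), x i.castSucc ^ 2) - x (Fin.last (m + 1)) ^ 2

/-- Membership in the Lorentzian similarity group
`Sim_L(ℝ^{m+2}) = ℝ^{m+2} ⋊ (O(m+1,1) × ℝ^+)`: the linear part is `λ • A` with `λ > 0`
and `A` a linear map preserving the Lorentz form. -/
def InSimL (m : ℕ) (g : AffGroup (m + 2)) : Prop :=
  ∃ (lam : ℝ) (A : Vec (m + 2) →ₗ[ℝ] Vec (m + 2)), 0 < lam ∧
    (∀ v, lorentzQ m (A v) = lorentzQ m v) ∧ ∀ v, g.linear v = lam • A v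

/-- Properly discontinuous action on `ℝ^n`. -/
def ProperlyDisc {n : ℕ} (Γ : Subgroup (AffGroup n)) : Prop :=
  ∀ K : Set (Vec n), IsCompact K →
    {γ : AffGroup n | γ ∈ Γ ∧ (⇑γ '' K ∩ K).Nonempty}.Finite

/-- Free action on `ℝ^n`. -/
def FreeAction {n : ℕ} (Γ : Subgroup (AffGroup n)) : Prop :=
  ∀ γ ∈ Γ, (∃ x : Vec n, γ x = x) → γ = 1

/-- Cocompact action on `ℝ^n`: some compact set meets every orbit. -/
def CocompactAction {n : ℕ} (Γ : Subgroup (AffGroup n)) : Prop :=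
  ∃ K : Set (Vec n), IsCompact K ∧ ∀ x : Vec n, ∃ γ ∈ Γ, γ x ∈ K

theorem aff_eq {n : ℕ} (g : AffGroup n) (p x : Vec n) : g (p + x) = g p + g.linear x := by
  have := g.map_vadd p x
  simp only [vadd_eq_add] at this
  rw [add_comm p x, this, add_comm]

theorem lin_mul {n : ℕ} (g h : AffGroup n) (x : Vec n) :
    (g * h).linear x = g.linear (h.linear x) := rfl

theorem app_mul {n : ℕ} (g h : AffGroup n) (x : Vec n) : (g * h) x = g (h x) := rfl

theorem lin_inv {n : ℕ} (g : AffGroup n) (x y : Vec n) (h : g.linear x = y) :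
    (g⁻¹).linear y = x := by
  subst h
  rw [← lin_mul, inv_mul_cancel]; rfl

theorem app_inv {n : ℕ} (g : AffGroup n) (x y : Vec n) (h : g x = y) :
    (g⁻¹) y = x := by
  subst h
  rw [← app_mul, inv_mul_cancel]; rfl

theorem zpow_lin_fix {n : ℕ} (γ : AffGroup n) (τ : Vec n) (h : γ.linear τ = τ) (k : ℤ) :
    (γ ^ k).linear τ = τ := by
  induction k using Int.induction_on with
  | zero => rfl
  | succ i ih => rw [zpow_add_one, lin_mul, h, ih]
  | pred i ih => rw [zpow_sub_one, lin_mul, lin_inv _ _ _ h, ih]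

theorem zpow_app {n : ℕ} (γ : AffGroup n) (p τ : Vec n) (hp : γ p = p + τ)
    (h : γ.linear τ = τ) (k : ℤ) :
    (γ ^ k) p = p + (k : ℝ) • τ := by
  have hinv : (γ⁻¹) p = p + (-1 : ℝ) • τ := by
    apply app_inv
    rw [aff_eq, hp, map_smul, h]; module
  induction k using Int.induction_on with
  | zero => simp
  | succ i ih =>
    rw [zpow_add_one, app_mul, hp, aff_eq, ih, zpow_lin_fix γ τ h]; push_cast; module
  | pred i ih =>
    rw [zpow_sub_one, app_mul, hinv, aff_eq, ih, map_smul, zpow_lin_fix γ τ h]; push_cast; module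

theorem zpow_phi {n : ℕ} (γ : AffGroup n) (φ : Vec n →ₗ[ℝ] ℝ)
    (h : ∀ x, φ (γ.linear x) = φ x) (k : ℤ) (x : Vec n) :
    φ ((γ ^ k).linear x) = φ x := by
  have hinv : ∀ x, φ ((γ⁻¹).linear x) = φ x := by
    intro x
    rw [← h, ← lin_mul, mul_inv_cancel]; rfl
  induction k using Int.induction_on generalizing x with
  | zero => rfl
  | succ i ih => rw [zpow_add_one, lin_mul, ih, h]
  | pred i ih => rw [zpow_sub_one, lin_mul, ih, hinv]

theorem aff_cont {n : ℕ} (g : AffGroup n) : Continuous g :=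
  AffineMap.continuous_of_finiteDimensional g.toAffineMap

open Filter Topology in
theorem const_zero {n : ℕ} (u : ℕ → Vec n) (hu : Tendsto u atTop (𝓝 0)) (J : Set ℕ)
    (hJ : J.Infinite) (c : Vec n) (hc : ∀ j ∈ J, u j = c) : c = 0 := by
  by_contra hne
  have h1 : ∀ᶠ j in atTop, u j ≠ c := hu.eventually_ne (Ne.symm hne)
  obtain ⟨N, hN⟩ := eventually_atTop.1 h1
  obtain ⟨j, hj, hlt⟩ := hJ.exists_gt N
  exact hN j hlt.le (hc j hj)

open Filter Topology in
/-- An element moving the translation vector of the axis out of the contracted hyperplane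
preserves the axis. -/
theorem axis_stab {n : ℕ} (Γ : Subgroup (AffGroup n)) (hPD : ProperlyDisc Γ)
    (γ : AffGroup n) (hγ : γ ∈ Γ) (p τ : Vec n) (φ : Vec n →ₗ[ℝ] ℝ)
    (hp : γ p = p + τ) (hLτ : γ.linear τ = τ) (hφτ : φ τ = 1)
    (hφL : ∀ x, φ (γ.linear x) = φ x) (r : ℝ) (hr0 : 0 ≤ r) (hr1 : r < 1)
    (hdecay : ∀ z, φ z = 0 → ∃ D : ℝ, ∀ j : ℕ, ‖(γ ^ (j : ℤ)).linear z‖ ≤ D * r ^ j)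
    (δ : AffGroup n) (hδ : δ ∈ Γ) (hne : φ (δ.linear τ) ≠ 0) :
    ∃ b c : ℝ, b ≠ 0 ∧ δ p = p + c • τ ∧ δ.linear τ = b • τ := by
  set b := φ (δ.linear τ) with hb
  set α := φ (δ p - p) with hα
  set z : Vec n := δ p - p - α • τ with hz
  set z' : Vec n := δ.linear τ - b • τ with hz'
  have hφz : φ z = 0 := by simp [hz, hφτ, hα]
  have hφz' : φ z' = 0 := by simp [hz', hφτ, hb]
  obtain ⟨D, hD⟩ := hdecay z hφz
  obtain ⟨D', hD'⟩ := hdecay z' hφz'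
  set s : ℕ → ℝ := fun j => -(j + α) / b with hs
  have hrt : Tendsto (fun j : ℕ => r ^ j) atTop (𝓝 0) := tendsto_pow_atTop_nhds_zero_of_lt_one hr0 hr1
  have hjrt : Tendsto (fun j : ℕ => (j : ℝ) * r ^ j) atTop (𝓝 0) :=
    tendsto_self_mul_const_pow_of_lt_one hr0 hr1
  have t1 : Tendsto (fun j : ℕ => (γ ^ (j : ℤ)).linear z) atTop (𝓝 0) := by
    apply squeeze_zero_norm hD
    simpa using hrt.const_mul D
  have t2 : Tendsto (fun j : ℕ => (γ ^ (j : ℤ)).linear z') atTop (𝓝 0) := by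
    apply squeeze_zero_norm hD'
    simpa using hrt.const_mul D'
  have t3 : Tendsto (fun j : ℕ => s j • (γ ^ (j : ℤ)).linear z') atTop (𝓝 0) := by
    have hle : ∀ j : ℕ, ‖s j • (γ ^ (j : ℤ)).linear z'‖ ≤
        (|D'| / |b|) * ((j : ℝ) * r ^ j) + (|α| * |D'| / |b|) * r ^ j := by
      intro j
      have hbp : 0 < |b| := abs_pos.2 hne
      have h1 : ‖(γ ^ (j : ℤ)).linear z'‖ ≤ |D'| * r ^ j :=
        (hD' j).trans (mul_le_mul_of_nonneg_right (le_abs_self _) (pow_nonneg hr0 j))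
      have h2 : |s j| ≤ (j + |α|) / |b| := by
        rw [hs]; simp only [abs_div, abs_neg]
        gcongr
        exact (abs_add_le _ _).trans (by simp)
      rw [norm_smul, Real.norm_eq_abs]
      calc |s j| * ‖(γ ^ (j : ℤ)).linear z'‖ ≤ ((j + |α|) / |b|) * (|D'| * r ^ j) := by gcongr
        _ = _ := by field_simp
    apply squeeze_zero_norm hle
    simpa using (hjrt.const_mul (|D'| / |b|)).add (hrt.const_mul (|α| * |D'| / |b|))
  set u : ℕ → Vec n := fun j => (γ ^ (j : ℤ)).linear z + s j • (γ ^ (j : ℤ)).linear z' with hu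
  have tu : Tendsto u atTop (𝓝 0) := by
    have := t1.add t3
    rw [add_zero] at this
    exact this
  have hφu : ∀ j, φ (u j) = 0 := by
    intro j
    simp only [hu, map_add, map_smul, zpow_phi γ φ hφL, hφz, hφz']; simp
  have hx : ∀ j : ℕ, (γ ^ (j : ℤ)) (δ (p + s j • τ)) = p + u j := by
    intro j
    have e1 : δ (p + s j • τ) = p + ((-(j : ℝ)) • τ + z + s j • z') := by
      rw [aff_eq, map_smul]
      have : δ p = p + z + α • τ := by rw [hz]; module
      have h2 : δ.linear τ = z' + b • τ := by rw [hz']; module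
      have h3 : s j * b = -(j + α) := by rw [hs]; field_simp
      rw [this, h2, smul_add, smul_smul, h3]; module
    rw [e1, aff_eq, zpow_app γ p τ hp hLτ]
    simp only [map_add, map_smul, zpow_lin_fix γ τ hLτ, hu]
    push_cast; module
  set k : ℕ → ℤ := fun j => ⌊s j⌋ with hk
  set g : ℕ → AffGroup n := fun j => γ ^ (j : ℤ) * δ * γ ^ (k j) with hg
  have hgx : ∀ j, g j (p + Int.fract (s j) • τ) = p + u j := by
    intro j
    rw [← hx j, hg]
    simp only [app_mul]
    congr 2
    rw [aff_eq, zpow_app γ p τ hp hLτ, map_smul, zpow_lin_fix γ τ hLτ, Int.fract]; module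
  obtain ⟨R, hR⟩ : ∃ R, ∀ j, ‖u j‖ ≤ R := by
    obtain ⟨R, hR⟩ := (tu.norm.bddAbove_range)
    exact ⟨R, fun j => hR ⟨j, rfl⟩⟩
  have hfin := hPD (Metric.closedBall p (max R ‖τ‖)) (isCompact_closedBall _ _)
  have hmem : ∀ j, g j ∈ {γ : AffGroup n | γ ∈ Γ ∧ (⇑γ '' (Metric.closedBall p (max R ‖τ‖)) ∩
      (Metric.closedBall p (max R ‖τ‖))).Nonempty} := by
    intro j
    refine ⟨Γ.mul_mem (Γ.mul_mem (Γ.zpow_mem hγ _) hδ) (Γ.zpow_mem hγ _), p + u j,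
      ⟨p + Int.fract (s j) • τ, ?_, hgx j⟩, ?_⟩
    · rw [mem_closedBall_iff_norm, add_sub_cancel_left, norm_smul, Real.norm_eq_abs,
        abs_of_nonneg (Int.fract_nonneg _)]
      refine le_trans ?_ (le_max_right _ _)
      have := (Int.fract_lt_one (s j)).le
      nlinarith [norm_nonneg τ]
    · rw [mem_closedBall_iff_norm, add_sub_cancel_left]
      exact (hR j).trans (le_max_left _ _)
  obtain ⟨G, hG⟩ : ∃ G, (g ⁻¹' {G}).Infinite := by
    by_contra hcon
    push Not at hcon
    have : (g ⁻¹' {γ : AffGroup n | γ ∈ Γ ∧ (⇑γ '' (Metric.closedBall p (max R ‖τ‖)) ∩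
      (Metric.closedBall p (max R ‖τ‖))).Nonempty}).Finite :=
      Set.Finite.preimage' hfin (fun b _ => hcon b)
    exact Set.infinite_univ (this.subset (fun j _ => hmem j))
  have hGτ : G.linear τ - b • τ = 0 := by
    refine const_zero _ t2 _ hG _ ?_
    intro j hj
    have hj : g j = G := hj
    rw [← hj, hg]
    simp only [lin_mul, zpow_lin_fix γ τ hLτ, hz', map_sub, map_smul]
  have hGp : G p - p - φ (G p - p) • τ = 0 := by
    refine const_zero _ tu _ hG _ ?_
    intro j hj
    have hj : g j = G := hj
    have h1 := hgx j
    rw [hj, aff_eq, map_smul, sub_eq_zero.1 hGτ] at h1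
    have h2 : G p - p = u j - Int.fract (s j) • b • τ := by
      rw [sub_eq_iff_eq_add, ← sub_eq_zero]
      rw [← sub_eq_zero] at h1
      rw [← h1]; module
    rw [h2]
    simp only [map_sub, map_smul, hφu, hφτ, smul_eq_mul]; module
  obtain ⟨j, hj⟩ := hG.nonempty
  have hj : g j = G := hj
  have hδG : δ = γ ^ (-(j : ℤ)) * G * γ ^ (-(k j)) := by
    rw [← hj, hg]; simp only [zpow_neg]; group
  refine ⟨b, -(k j) * b + φ (G p - p) + (-(j : ℤ) : ℤ), hne, ?_, ?_⟩
  · have hGp' : G p = p + φ (G p - p) • τ := by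
      rw [← sub_eq_zero, ← hGp]; module
    generalize φ (G p - p) = c at *
    rw [hδG, app_mul, zpow_app γ p τ hp hLτ, app_mul, aff_eq, hGp', map_smul, sub_eq_zero.1 hGτ,
      add_assoc, aff_eq, zpow_app γ p τ hp hLτ]
    simp only [map_add, map_smul, zpow_lin_fix γ τ hLτ]
    push_cast; module
  · rw [hδG, lin_mul, lin_mul, zpow_lin_fix γ τ hLτ, sub_eq_zero.1 hGτ, map_smul,
      zpow_lin_fix γ τ hLτ]

theorem dyn {n : ℕ} (Γ : Subgroup (AffGroup n)) (hPD : ProperlyDisc Γ) (hCC : CocompactAction Γ)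
    (γ : AffGroup n) (hγ : γ ∈ Γ) (p τ w : Vec n) (φ : Vec n →ₗ[ℝ] ℝ)
    (hp : γ p = p + τ) (hLτ : γ.linear τ = τ) (hφτ : φ τ = 1)
    (hφL : ∀ x, φ (γ.linear x) = φ x) (r : ℝ) (hr0 : 0 ≤ r) (hr1 : r < 1)
    (hdecay : ∀ z, φ z = 0 → ∃ D : ℝ, ∀ j : ℕ, ‖(γ ^ (j : ℤ)).linear z‖ ≤ D * r ^ j)
    (hw : w ≠ 0) (hφw : φ w = 0)
    (hnull : ∀ δ ∈ Γ, φ (δ.linear τ) = 0 → ∃ c : ℝ, δ.linear τ = c • w) : False := by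
  have hst := axis_stab Γ hPD γ hγ p τ φ hp hLτ hφτ hφL r hr0 hr1 hdecay
  have hτ0 : τ ≠ 0 := by rintro rfl; simp at hφτ
  -- the finite set
  set B := Metric.closedBall p ‖τ‖ with hB
  set F : Set (AffGroup n) := {γ | γ ∈ Γ ∧ (⇑γ '' B ∩ B).Nonempty} with hF
  have hFfin : F.Finite := hPD B (isCompact_closedBall _ _)
  have hS : ∀ δ ∈ Γ, φ (δ.linear τ) ≠ 0 → ∃ i : ℤ, ∃ f ∈ F, δ = γ ^ i * f := by
    intro δ hδ hne
    obtain ⟨b, c, hb, h1, h2⟩ := hst δ hδ hne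
    refine ⟨⌊c⌋, γ ^ (-⌊c⌋) * δ, ⟨Γ.mul_mem (Γ.zpow_mem hγ _) hδ, (γ ^ (-⌊c⌋) * δ) p,
      ⟨p, by simp [hB], rfl⟩, ?_⟩, by group⟩
    rw [app_mul, h1, aff_eq, zpow_app γ p τ hp hLτ, map_smul, zpow_lin_fix γ τ hLτ]
    have : p + ((-⌊c⌋ : ℤ) : ℝ) • τ + c • τ = p + Int.fract c • τ := by
      rw [Int.fract]; push_cast; module
    rw [this, hB, mem_closedBall_iff_norm, add_sub_cancel_left, norm_smul, Real.norm_eq_abs,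
        abs_of_nonneg (Int.fract_nonneg _)]
    have := (Int.fract_lt_one c).le
    nlinarith [norm_nonneg τ]
  have hinv : ∀ δ ∈ Γ, φ (δ.linear τ) ≠ 0 → φ ((δ⁻¹).linear τ) ≠ 0 := by
    intro δ hδ hne
    obtain ⟨b, c, hb, h1, h2⟩ := hst δ hδ hne
    have : (δ⁻¹).linear τ = b⁻¹ • τ := by
      apply lin_inv
      rw [map_smul, h2, smul_smul, inv_mul_cancel₀ hb, one_smul]
    rw [this, map_smul, hφτ]; simpa using hb
  have hcof : ∀ δ δ' : AffGroup n, δ ∈ Γ → δ' ∈ Γ → φ (δ.linear τ) = 0 → φ (δ'.linear τ) = 0 →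
      φ ((δ * δ'⁻¹).linear τ) ≠ 0 := by
    intro δ δ' hδ hδ' h h'
    have k1 : φ ((δ⁻¹).linear τ) = 0 := by
      by_contra hh
      have := hinv _ (Γ.inv_mem hδ) hh
      rw [inv_inv] at this; exact this h
    have k2 : φ ((δ'⁻¹).linear τ) = 0 := by
      by_contra hh
      have := hinv _ (Γ.inv_mem hδ') hh
      rw [inv_inv] at this; exact this h'
    obtain ⟨c, hc⟩ := hnull _ (Γ.inv_mem hδ) k1
    obtain ⟨c', hc'⟩ := hnull _ (Γ.inv_mem hδ') k2
    have hc0 : c ≠ 0 := by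
      rintro rfl
      rw [zero_smul] at hc
      exact hτ0 ((LinearEquiv.map_eq_zero_iff _).1 hc)
    have hc0' : c' ≠ 0 := by
      rintro rfl
      rw [zero_smul] at hc'
      exact hτ0 ((LinearEquiv.map_eq_zero_iff _).1 hc')
    have e : (δ'⁻¹).linear τ = (c' / c) • (δ⁻¹).linear τ := by
      rw [hc, hc', smul_smul]; field_simp
    rw [lin_mul, e, map_smul, ← lin_mul, mul_inv_cancel, map_smul]
    have : (1 : AffGroup n).linear τ = τ := rfl
    rw [this, hφτ]
    simp [hc0, hc0']
  obtain ⟨F', hF'fin, hF'⟩ : ∃ F' : Set (AffGroup n), F'.Finite ∧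
      ∀ δ ∈ Γ, ∃ i : ℤ, ∃ f ∈ F', δ = γ ^ i * f := by
    by_cases hex : ∃ δ₀ ∈ Γ, φ (δ₀.linear τ) = 0
    · obtain ⟨δ₀, hδ₀, h0⟩ := hex
      refine ⟨F ∪ (fun f => f * δ₀) '' F, hFfin.union (hFfin.image _), ?_⟩
      intro δ hδ
      by_cases h : φ (δ.linear τ) = 0
      · obtain ⟨i, f, hf, e⟩ := hS _ (Γ.mul_mem hδ (Γ.inv_mem hδ₀)) (hcof δ δ₀ hδ hδ₀ h h0)
        refine ⟨i, f * δ₀, Or.inr ⟨f, hf, rfl⟩, ?_⟩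
        rw [← mul_assoc, ← e]; group
      · obtain ⟨i, f, hf, e⟩ := hS _ hδ h
        exact ⟨i, f, Or.inl hf, e⟩
    · push Not at hex
      exact ⟨F, hFfin, fun δ hδ => hS δ hδ (hex δ hδ)⟩
  obtain ⟨K, hK, hKcov⟩ := hCC
  set Kc : Set (Vec n) := ⋃ f ∈ F', f '' K with hKc
  have hKc_compact : IsCompact Kc := hF'fin.isCompact_biUnion (fun f _ => hK.image (aff_cont f))
  have hcov : ∀ x : Vec n, ∃ i : ℤ, ∃ y ∈ Kc, (γ ^ i) y = x := by
    intro x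
    obtain ⟨g, hg, hgx⟩ := hKcov x
    obtain ⟨i, f, hf, e⟩ := hF' _ (Γ.inv_mem hg)
    refine ⟨i, f (g x), Set.mem_biUnion hf ⟨g x, hgx, rfl⟩, ?_⟩
    rw [← app_mul, ← e, ← app_mul, inv_mul_cancel]; rfl
  have hφc : Continuous φ := LinearMap.continuous_of_finiteDimensional φ
  obtain ⟨R, hR⟩ : ∃ R : ℝ, ∀ y ∈ Kc, |φ (y - p)| ≤ R := by
    have : Continuous (fun y => φ (y - p)) := hφc.comp (continuous_id.sub continuous_const)
    obtain ⟨R, hR⟩ := hKc_compact.exists_bound_of_continuousOn this.continuousOn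
    exact ⟨R, fun y hy => by simpa using hR y hy⟩
  set T : Set (Vec n) := ⋃ i ∈ Set.Icc (-⌈R⌉) ⌈R⌉, (γ ^ i) '' Kc with hT
  have hTc : IsCompact T :=
    (Set.finite_Icc _ _).isCompact_biUnion (fun i _ => hKc_compact.image (aff_cont _))
  have hray : ∀ s : ℝ, p + s • w ∈ T := by
    intro s
    obtain ⟨i, y, hy, e⟩ := hcov (p + s • w)
    have h1 : (γ ^ i) y = p + (i : ℝ) • τ + (γ ^ i).linear (y - p) := by
      have := aff_eq (γ ^ i) p (y - p)
      rw [add_sub_cancel, zpow_app γ p τ hp hLτ] at this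
      exact this
    have h2 : φ (y - p) = - i := by
      rw [h1, add_assoc, add_right_inj] at e
      have := congrArg φ e
      rw [map_add, map_smul, map_smul, zpow_phi γ φ hφL, hφτ, hφw] at this
      simp only [smul_eq_mul, mul_one, mul_zero] at this; linarith
    have h3 := hR y hy
    rw [h2, abs_neg] at h3
    have h4 := abs_le.1 (h3.trans (Int.le_ceil R))
    refine Set.mem_biUnion (x := i) ⟨?_, ?_⟩ ⟨y, hy, e⟩
    · exact_mod_cast h4.1
    · exact_mod_cast h4.2
  obtain ⟨M, hM⟩ := hTc.isBounded.exists_norm_le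
  have hwp : 0 < ‖w‖ := norm_pos_iff.2 hw
  have := hM _ (hray ((|M| + ‖p‖ + 1) / ‖w‖))
  have h5 : ‖((|M| + ‖p‖ + 1) / ‖w‖) • w‖ = |M| + ‖p‖ + 1 := by
    rw [norm_smul, Real.norm_eq_abs, abs_of_nonneg (by positivity)]; field_simp
  have h6 := norm_sub_le (p + ((|M| + ‖p‖ + 1) / ‖w‖) • w) p
  rw [add_sub_cancel_left, h5] at h6
  linarith [le_abs_self M]

/-- The Lorentz bilinear form. -/
def lorB (m : ℕ) : Vec (m + 2) →ₗ[ℝ] Vec (m + 2) →ₗ[ℝ] ℝ :=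
  LinearMap.mk₂ ℝ (fun x y => (∑ i : Fin (m + 1), x i.castSucc * y i.castSucc)
      - x (Fin.last (m + 1)) * y (Fin.last (m + 1)))
    (by intros; simp only [Pi.add_apply, add_mul, Finset.sum_add_distrib]; ring)
    (by intros; simp only [Pi.smul_apply, smul_eq_mul, mul_assoc, ← Finset.mul_sum]; ring)
    (by intros; simp only [Pi.add_apply, mul_add, Finset.sum_add_distrib]; ring)
    (by intros; simp only [Pi.smul_apply, smul_eq_mul, mul_left_comm, ← Finset.mul_sum]; ring)

theorem lorB_apply (m : ℕ) (x y : Vec (m + 2)) :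
    lorB m x y = (∑ i : Fin (m + 1), x i.castSucc * y i.castSucc)
      - x (Fin.last (m + 1)) * y (Fin.last (m + 1)) := rfl

theorem lorB_self (m : ℕ) (x : Vec (m + 2)) : lorB m x x = lorentzQ m x := by
  simp only [lorB_apply, lorentzQ, pow_two]

theorem lorB_comm (m : ℕ) (x y : Vec (m + 2)) : lorB m x y = lorB m y x := by
  simp only [lorB_apply, mul_comm]

theorem lorB_pres (m : ℕ) (A : Vec (m + 2) →ₗ[ℝ] Vec (m + 2))
    (hA : ∀ v, lorentzQ m (A v) = lorentzQ m v) (x y : Vec (m + 2)) :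
    lorB m (A x) (A y) = lorB m x y := by
  have h := hA (x + y)
  simp only [← lorB_self, map_add, LinearMap.add_apply] at h hA
  rw [hA x, hA y, lorB_comm m (A y) (A x), lorB_comm m y x] at h
  linarith

theorem null_last (m : ℕ) (v : Vec (m + 2)) (hv : v ≠ 0) (hQ : lorentzQ m v = 0) :
    v (Fin.last (m + 1)) ≠ 0 := by
  intro h
  apply hv
  rw [lorentzQ, h] at hQ
  have h0 : ∑ i : Fin (m + 1), v i.castSucc ^ 2 = 0 := by simpa using hQ
  rw [Finset.sum_eq_zero_iff_of_nonneg (fun i _ => sq_nonneg _)] at h0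
  ext i
  refine Fin.lastCases h (fun i => ?_) i
  simpa using h0 i (Finset.mem_univ i)

theorem null_ortho (m : ℕ) (v u : Vec (m + 2)) (hQ : lorentzQ m v = 0) (hB : lorB m v u = 0) :
    v (Fin.last (m + 1)) ^ 2 * lorentzQ m u =
      ∑ i : Fin (m + 1), (v (Fin.last (m + 1)) * u i.castSucc
        - u (Fin.last (m + 1)) * v i.castSucc) ^ 2 := by
  rw [lorentzQ] at *
  rw [lorB_apply] at hB
  set a := v (Fin.last (m + 1))
  set b := u (Fin.last (m + 1))
  have : ∑ i : Fin (m + 1), (a * u i.castSucc - b * v i.castSucc) ^ 2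
     = a ^ 2 * (∑ i : Fin (m + 1), u i.castSucc ^ 2)
       - 2 * a * b * (∑ i : Fin (m + 1), v i.castSucc * u i.castSucc)
       + b ^ 2 * (∑ i : Fin (m + 1), v i.castSucc ^ 2) := by
    simp only [Finset.mul_sum, ← Finset.sum_sub_distrib, ← Finset.sum_add_distrib]
    exact Finset.sum_congr rfl (fun i _ => by ring)
  rw [this]
  linear_combination (-b^2) * hQ + 2 * a * b * hB

theorem ortho_nonneg (m : ℕ) (v u : Vec (m + 2)) (hv : v ≠ 0) (hQ : lorentzQ m v = 0)
    (hB : lorB m v u = 0) : 0 ≤ lorentzQ m u := by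
  have h := null_ortho m v u hQ hB
  have h1 : 0 < v (Fin.last (m + 1)) ^ 2 := by have := null_last m v hv hQ; positivity
  have h2 : 0 ≤ v (Fin.last (m + 1)) ^ 2 * lorentzQ m u := by
    rw [h]; exact Finset.sum_nonneg (fun i _ => sq_nonneg _)
  exact nonneg_of_mul_nonneg_right h2 h1

theorem ortho_null (m : ℕ) (v u : Vec (m + 2)) (hv : v ≠ 0) (hQ : lorentzQ m v = 0)
    (hB : lorB m v u = 0) (hu : lorentzQ m u = 0) : ∃ c : ℝ, u = c • v := by
  have h := null_ortho m v u hQ hB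
  have h1 := null_last m v hv hQ
  rw [hu, mul_zero, eq_comm, Finset.sum_eq_zero_iff_of_nonneg (fun i _ => sq_nonneg _)] at h
  refine ⟨u (Fin.last (m + 1)) / v (Fin.last (m + 1)), ?_⟩
  ext i
  refine Fin.lastCases ?_ (fun i => ?_) i
  · simp; field_simp
  · have := h i (Finset.mem_univ i)
    have := pow_eq_zero_iff (two_ne_zero) |>.1 this
    simp only [Pi.smul_apply, smul_eq_mul]; field_simp; linarith

theorem lorB_nondeg (m : ℕ) (v : Vec (m + 2)) (hv : v ≠ 0) (hQ : lorentzQ m v = 0) :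
    ∃ x, lorB m v x ≠ 0 := by
  refine ⟨Pi.single (Fin.last (m + 1)) 1, ?_⟩
  have h1 := null_last m v hv hQ
  rw [lorB_apply]
  simp [Pi.single_apply, h1, Fin.castSucc_ne_last]

theorem quad_bound {n : ℕ} (N : Vec n → ℝ) (hc : Continuous N)
    (hh : ∀ (c : ℝ) x, N (c • x) = c ^ 2 * N x) (hpos : ∀ x, x ≠ 0 → 0 < N x) :
    ∃ c : ℝ, 0 < c ∧ ∀ x, c * ‖x‖ ^ 2 ≤ N x := by
  by_cases hne : (Metric.sphere (0 : Vec n) 1).Nonempty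
  · obtain ⟨x₀, hx₀, hmin⟩ := (isCompact_sphere (0 : Vec n) 1).exists_isMinOn hne hc.continuousOn
    have hx0 : x₀ ≠ 0 := by rintro rfl; simp at hx₀
    refine ⟨N x₀, hpos _ hx0, fun x => ?_⟩
    by_cases hx : x = 0
    · subst hx
      have := hh 0 0
      simp at this; simp [this]
    · have hxn : 0 < ‖x‖ := norm_pos_iff.2 hx
      have h1 : ‖x‖⁻¹ • x ∈ Metric.sphere (0 : Vec n) 1 := by
        simp [norm_smul, hxn.ne']
      have h2 : N x₀ ≤ N (‖x‖⁻¹ • x) := hmin h1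
      rw [hh] at h2
      have h3 : ‖x‖ ^ 2 * (‖x‖⁻¹ ^ 2 * N x) = N x := by field_simp
      nlinarith [mul_le_mul_of_nonneg_left h2 (sq_nonneg ‖x‖)]
  · refine ⟨1, one_pos, fun x => ?_⟩
    have hx : x = 0 := by
      by_contra hx
      have hxn : 0 < ‖x‖ := norm_pos_iff.2 hx
      exact hne ⟨‖x‖⁻¹ • x, by simp [norm_smul, hxn.ne']⟩
    subst hx
    have := hh 0 0
    simp at this; simp [this]

theorem no_contract (m : ℕ) (Γ : Subgroup (AffGroup (m + 2)))
    (hSim : ∀ γ ∈ Γ, InSimL m γ)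
    (hFree : FreeAction Γ) (hPD : ProperlyDisc Γ) (hCC : CocompactAction Γ)
    (γ : AffGroup (m + 2)) (hγ : γ ∈ Γ) (lam : ℝ) (A : Vec (m + 2) →ₗ[ℝ] Vec (m + 2))
    (hlam : 0 < lam) (hA : ∀ v, lorentzQ m (A v) = lorentzQ m v)
    (hγA : ∀ v, γ.linear v = lam • A v) (hlt : lam < 1) : False := by
  have hAB := lorB_pres m A hA
  have hQs : ∀ (c : ℝ) x, lorentzQ m (c • x) = c ^ 2 * lorentzQ m x := by
    intro c x; simp only [← lorB_self, map_smul, LinearMap.smul_apply, smul_eq_mul]; ring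
  have hlam2 : lam ^ 2 < 1 := by nlinarith
  have hLB : ∀ x y, lorB m (γ.linear x) (γ.linear y) = lam ^ 2 * lorB m x y := by
    intro x y
    rw [hγA, hγA, map_smul, map_smul, LinearMap.smul_apply, hAB, smul_eq_mul, smul_eq_mul]; ring
  have hLQ : ∀ x, lorentzQ m (γ.linear x) = lam ^ 2 * lorentzQ m x := by
    intro x; rw [← lorB_self, hLB, lorB_self]
  -- γ is not the identity
  have hγ1 : γ ≠ 1 := by
    rintro rfl
    have := hLQ (Pi.single (Fin.last (m + 1)) 1)
    have h2 : lorentzQ m (Pi.single (Fin.last (m + 1)) 1) = -1 := by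
      simp [lorentzQ, Pi.single_apply, Fin.castSucc_ne_last]
    have h3 : (1 : AffGroup (m + 2)).linear (Pi.single (Fin.last (m + 1)) 1)
      = Pi.single (Fin.last (m + 1)) 1 := rfl
    rw [h3, h2] at this
    linarith
  have hnofix : ∀ x, γ x ≠ x := fun x hx => hγ1 (hFree γ hγ ⟨x, hx⟩)
  have hγ0 : ∀ x, γ x = γ 0 + γ.linear x := by
    intro x; have := aff_eq γ 0 x; rwa [zero_add] at this
  set L : Vec (m + 2) →ₗ[ℝ] Vec (m + 2) := (γ.linear : Vec (m + 2) →ₗ[ℝ] Vec (m + 2)) with hL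
  have hLa : ∀ x, L x = γ.linear x := fun x => rfl
  obtain ⟨v, hv, hLv⟩ : ∃ v, v ≠ 0 ∧ γ.linear v = v := by
    by_contra hcon
    push Not at hcon
    have hinj : Function.Injective (L - LinearMap.id : Vec (m + 2) →ₗ[ℝ] Vec (m + 2)) := by
      rw [injective_iff_map_eq_zero]
      intro x hx
      by_contra hx0
      apply hcon x hx0
      rw [LinearMap.sub_apply, LinearMap.id_apply, sub_eq_zero] at hx
      exact hx
    obtain ⟨x, hx⟩ := (LinearMap.injective_iff_surjective.1 hinj) (-(γ 0))
    apply hnofix x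
    rw [LinearMap.sub_apply, LinearMap.id_apply, hLa] at hx
    rw [hγ0, ← sub_eq_zero, add_sub_assoc, hx]; simp
  have hQv : lorentzQ m v = 0 := by
    have := hLQ v; rw [hLv] at this; nlinarith
  obtain ⟨w, hw, hLw⟩ : ∃ w, w ≠ 0 ∧ γ.linear w = lam ^ 2 • w := by
    by_contra hcon
    push Not at hcon
    have hinj : Function.Injective (L - lam ^ 2 • LinearMap.id : Vec (m + 2) →ₗ[ℝ] Vec (m + 2)) := by
      rw [injective_iff_map_eq_zero]
      intro x hx
      by_contra hx0
      apply hcon x hx0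
      rw [LinearMap.sub_apply, LinearMap.smul_apply, LinearMap.id_apply, sub_eq_zero] at hx
      exact hx
    obtain ⟨y, hy⟩ := lorB_nondeg m v hv hQv
    obtain ⟨x, hx⟩ := (LinearMap.injective_iff_surjective.1 hinj) y
    apply hy
    rw [← hx, LinearMap.sub_apply, LinearMap.smul_apply, LinearMap.id_apply, hLa, map_sub,
      map_smul]
    nth_rewrite 1 [← hLv]
    rw [hLB, smul_eq_mul, sub_self]
  have hQw : lorentzQ m w = 0 := by
    have := hLQ w
    rw [hLw, hQs] at this
    have h2 : lam ^ 2 * (1 - lam ^ 2) * lorentzQ m w = 0 := by linarith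
    have h3 : lam ^ 2 * (1 - lam ^ 2) ≠ 0 := by
      have : 0 < 1 - lam ^ 2 := by linarith
      positivity
    exact (mul_eq_zero.1 h2).resolve_left h3
  set β := lorB m w v with hβ
  have hβ0 : β ≠ 0 := by
    intro h
    obtain ⟨c, hc⟩ := ortho_null m w v hw hQw h hQv
    have h1 : lam ^ 2 • v = v := by
      rw [hc, smul_comm, ← hLw, ← map_smul, ← hc, hLv]
    have h2 : (1 - lam ^ 2) • v = 0 := by rw [sub_smul, one_smul, h1, sub_self]
    rcases smul_eq_zero.1 h2 with h | h
    · linarith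
    · exact hv h
  have hlam20 : lam ^ 2 ≠ 0 := by positivity
  have hφ0 : ∀ x, lorB m w (γ.linear x) = lorB m w x := by
    intro x
    have h := hLB w x
    rw [hLw, map_smul, LinearMap.smul_apply, smul_eq_mul] at h
    exact mul_left_cancel₀ hlam20 h
  have hψ0 : ∀ x, lorB m v (γ.linear x) = lam ^ 2 * lorB m v x := by
    intro x
    have h := hLB v x
    rwa [hLv] at h
  set N : Vec (m + 2) → ℝ := fun x =>
    lorB m w x ^ 2 + lorB m v x ^ 2 + (lorentzQ m x - 2 * lorB m w x * lorB m v x / β) with hN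
  have hNpos : ∀ x, x ≠ 0 → 0 < N x := by
    intro x hx
    set u := x - (lorB m w x / β) • v - (lorB m v x / β) • w with hu
    have hvw : lorB m v w = β := lorB_comm m v w
    have hvv : lorB m v v = 0 := by rw [lorB_self, hQv]
    have hww : lorB m w w = 0 := by rw [lorB_self, hQw]
    have hwu : lorB m w u = 0 := by
      simp only [hu, map_sub, map_smul, smul_eq_mul, hww, ← hβ]; field_simp; ring
    have hvu : lorB m v u = 0 := by
      simp only [hu, map_sub, map_smul, smul_eq_mul, hvv, hvw]; field_simp; ring
    have hQu : lorentzQ m u = lorentzQ m x - 2 * lorB m w x * lorB m v x / β := by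
      have e1 : lorB m u u = lorB m u x := by
        nth_rewrite 2 [hu]
        rw [map_sub, map_sub, map_smul, map_smul, lorB_comm m u v, lorB_comm m u w, hwu, hvu]
        simp
      have e2 : lorB m x u = lorentzQ m x - 2 * lorB m w x * lorB m v x / β := by
        rw [hu, map_sub, map_sub, map_smul, map_smul, lorB_comm m x v, lorB_comm m x w, lorB_self]
        simp only [smul_eq_mul]; ring
      rw [← lorB_self, e1, lorB_comm, e2]
    have hq : 0 ≤ lorentzQ m u := ortho_nonneg m v u hv hQv hvu
    have hNx : N x = lorB m w x ^ 2 + lorB m v x ^ 2 + lorentzQ m u := by rw [hQu]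
    by_contra hcon
    push Not at hcon
    rw [hNx] at hcon
    have h1 : lorB m w x = 0 := by nlinarith [sq_nonneg (lorB m w x), sq_nonneg (lorB m v x)]
    have h2 : lorB m v x = 0 := by nlinarith [sq_nonneg (lorB m w x), sq_nonneg (lorB m v x)]
    have h3 : lorentzQ m x = 0 := by
      have : lorentzQ m u = 0 := by nlinarith [sq_nonneg (lorB m w x), sq_nonneg (lorB m v x)]
      rw [hQu, h1] at this; simpa using this
    obtain ⟨c, hc⟩ := ortho_null m v x hv hQv h2 h3
    rw [hc, map_smul, smul_eq_mul, ← hβ] at h1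
    rcases mul_eq_zero.1 h1 with h | h
    · exact hx (by rw [hc, h, zero_smul])
    · exact hβ0 h
  have hNh : ∀ (c : ℝ) x, N (c • x) = c ^ 2 * N x := by
    intro c x
    simp only [hN, map_smul, hQs, smul_eq_mul]; field_simp
  have hNc : Continuous N := by
    have c1 : Continuous (lorB m w) := LinearMap.continuous_of_finiteDimensional _
    have c2 : Continuous (lorB m v) := LinearMap.continuous_of_finiteDimensional _
    have c3 : Continuous (lorentzQ m) := by unfold lorentzQ; fun_prop
    simp only [hN]; fun_prop
  obtain ⟨c, hc, hcN⟩ := quad_bound N hNc hNh hNpos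
  have hNL : ∀ z, lorB m w z = 0 → N (γ.linear z) ≤ lam ^ 2 * N z := by
    intro z hz
    simp only [hN, hφ0, hψ0, hLQ, hz]
    have h1 : lam ^ 2 * lam ^ 2 * lorB m v z ^ 2 ≤ lam ^ 2 * lorB m v z ^ 2 := by
      apply mul_le_mul_of_nonneg_right _ (sq_nonneg _)
      nlinarith [sq_nonneg lam]
    simp only [mul_zero, zero_mul, zero_div]
    nlinarith
  -- the axis
  have hsur : Function.Surjective (L - LinearMap.id + (lorB m w).smulRight v : Vec (m + 2) →ₗ[ℝ] Vec (m + 2)) := by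
    apply LinearMap.injective_iff_surjective.1
    rw [injective_iff_map_eq_zero]
    intro x hx
    simp only [LinearMap.add_apply, LinearMap.sub_apply, LinearMap.id_apply,
      LinearMap.smulRight_apply, hLa] at hx
    have h1 := congrArg (lorB m w) hx
    simp only [map_add, map_sub, map_smul, hφ0, sub_self, zero_add, map_zero, smul_eq_mul,
      ← hβ] at h1
    have h2 : lorB m w x = 0 := (mul_eq_zero.1 h1).resolve_right hβ0
    rw [h2, zero_smul, add_zero, sub_eq_zero] at hx
    by_contra hx0
    have h3 := hNL x h2
    rw [hx] at h3
    nlinarith [hNpos x hx0]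
  obtain ⟨p, hp⟩ := hsur (-(γ 0))
  simp only [LinearMap.add_apply, LinearMap.sub_apply, LinearMap.id_apply,
      LinearMap.smulRight_apply, hLa] at hp
  set t : ℝ := - lorB m w p with ht
  have hpt : γ p = p + t • v := by
    rw [hγ0, ht, ← sub_eq_zero]
    have : γ 0 = -(γ.linear p - p + lorB m w p • v) := by rw [hp, neg_neg]
    rw [this]; module
  have ht0 : t ≠ 0 := by
    intro h
    rw [h, zero_smul, add_zero] at hpt
    exact hnofix p hpt
  have htβ : t * β ≠ 0 := mul_ne_zero ht0 hβ0
  refine dyn Γ hPD hCC γ hγ p (t • v) w ((t * β)⁻¹ • lorB m w) hpt (by rw [map_smul, hLv]) ?_ ?_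
    lam hlam.le hlt ?_ hw ?_ ?_
  · rw [LinearMap.smul_apply, map_smul, ← hβ, smul_eq_mul, smul_eq_mul]
    exact inv_mul_cancel₀ htβ
  · intro x
    rw [LinearMap.smul_apply, LinearMap.smul_apply, hφ0]
  · intro z hz
    have hz : lorB m w z = 0 := by
      rw [LinearMap.smul_apply, smul_eq_mul] at hz
      exact (mul_eq_zero.1 hz).resolve_left (inv_ne_zero htβ)
    have key : ∀ j : ℕ, lorB m w ((γ ^ (j : ℤ)).linear z) = 0 ∧
        N ((γ ^ (j : ℤ)).linear z) ≤ (lam ^ j) ^ 2 * N z := by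
      intro j
      induction j with
      | zero =>
        refine ⟨hz, ?_⟩
        have : (γ ^ ((0 : ℕ) : ℤ)).linear z = z := rfl
        rw [this]; simp
      | succ j ih =>
        have e : (γ ^ ((j + 1 : ℕ) : ℤ)).linear z = γ.linear ((γ ^ (j : ℤ)).linear z) := by
          rw [← lin_mul]; congr 2; push_cast; rw [zpow_add_one, (Commute.self_zpow γ (j : ℤ)).eq]
        rw [e]
        refine ⟨by rw [hφ0]; exact ih.1, (hNL _ ih.1).trans ?_⟩
        calc lam ^ 2 * N ((γ ^ (j : ℤ)).linear z) ≤ lam ^ 2 * ((lam ^ j) ^ 2 * N z) :=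
              mul_le_mul_of_nonneg_left ih.2 (sq_nonneg _)
          _ = _ := by ring
    have hNz : 0 ≤ N z := le_trans (by positivity) (hcN z)
    refine ⟨Real.sqrt (N z / c), fun j => ?_⟩
    apply abs_le_of_sq_le_sq' _ (by positivity) |>.2
    rw [mul_pow, Real.sq_sqrt (by positivity)]
    have h1 := (hcN _).trans (key j).2
    rw [div_mul_eq_mul_div, le_div_iff₀ hc]
    linarith
  · rw [LinearMap.smul_apply, lorB_self, hQw, smul_zero]
  · intro δ hδ h
    have h : lorB m w (δ.linear (t • v)) = 0 := by
      rw [LinearMap.smul_apply, smul_eq_mul] at h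
      exact (mul_eq_zero.1 h).resolve_left (inv_ne_zero htβ)
    obtain ⟨l, A', hl, hA', hδA⟩ := hSim δ hδ
    refine ortho_null m w _ hw hQw h ?_
    rw [hδA, hQs, hA', hQs, hQv]; simp

/-- Every compact complete Lorentzian similarity manifold is a Lorentzian flat space
form: if `Γ ≤ Sim_L(ℝ^{m+2})` acts freely, properly discontinuously and cocompactly on
`ℝ^{m+2}`, then every element of `Γ` has similarity factor `λ = 1`,
i.e. `Γ ⊆ E(m+1,1)`. -/
theorem statement4 (m : ℕ) (Γ : Subgroup (AffGroup (m + 2)))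
    (hSim : ∀ γ ∈ Γ, InSimL m γ)
    (hFree : FreeAction Γ) (hPD : ProperlyDisc Γ) (hCC : CocompactAction Γ) :
    ∀ γ ∈ Γ, ∀ (lam : ℝ) (A : Vec (m + 2) →ₗ[ℝ] Vec (m + 2)), 0 < lam →
      (∀ v, lorentzQ m (A v) = lorentzQ m v) →
      (∀ v, γ.linear v = lam • A v) → lam = 1 := by
  intro γ hγ lam A hlam hA hγA
  rcases lt_trichotomy lam 1 with h | h | h
  · exact (no_contract m Γ hSim hFree hPD hCC γ hγ lam A hlam hA hγA h).elim
  · exact h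
  · exfalso
    obtain ⟨l, A', hl, hA', hδA⟩ := hSim _ (Γ.inv_mem hγ)
    refine no_contract m Γ hSim hFree hPD hCC γ⁻¹ (Γ.inv_mem hγ) l A' hl hA' hδA ?_
    have hQs : ∀ (c : ℝ) x, lorentzQ m (c • x) = c ^ 2 * lorentzQ m x := by
      intro c x; simp only [← lorB_self, map_smul, LinearMap.smul_apply, smul_eq_mul]; ring
    set e : Vec (m + 2) := Pi.single (Fin.last (m + 1)) 1 with he
    have h2 : lorentzQ m e = -1 := by
      simp [he, lorentzQ, Pi.single_apply, Fin.castSucc_ne_last]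
    have h3 : (γ⁻¹).linear (γ.linear e) = e := lin_inv γ e _ rfl
    have h4 := congrArg (lorentzQ m) h3
    rw [hδA, hQs, hA', hγA, hQs, hA, h2] at h4
    have h5 : (l * lam) ^ 2 = 1 := by nlinarith
    by_contra hcon
    push Not at hcon
    have : 1 < l * lam := by nlinarith
    nlinarith
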